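/- For every ε > 0 there exists N such that every tournament T on n ≥ N vertices with c3(T) ≥ 1/16 satisfies c4(T) ≥ 3/64 − ε, where c3(T) is the fraction of 3-element vertex subsets spanning a cyclic triangle and c4(T) is the fraction of 4-element vertex subsets whose induced subtournament contains a directed 4-cycle. -/

import Mathlib

open Finset

/-- A tournament on `Fin n`: an orientation of the complete graph, i.e. no loops and
for all distinct `x, y` exactly one of `r x y`, `r y x` holds. -/
def IsTournament {n : ℕ} (r : Fin n → Fin n → Prop) : Prop :=
  (∀ x, ¬ r x x) ∧ ∀ x y : Fin n, x ≠ y → ((r x y ∧ ¬ r y x) ∨ (r y x ∧ ¬ r x y))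

/-- `s` spans a cyclic triangle: `s = {x,y,z}` with `x→y→z→x`. -/
def IsCyclicTriple {n : ℕ} (r : Fin n → Fin n → Prop) (s : Finset (Fin n)) : Prop :=
  ∃ x y z : Fin n, x ≠ y ∧ y ≠ z ∧ x ≠ z ∧ s = {x, y, z} ∧ r x y ∧ r y z ∧ r z x

/-- `s` spans a transitive triple. -/
def IsTransTriple {n : ℕ} (r : Fin n → Fin n → Prop) (s : Finset (Fin n)) : Prop :=
  ∃ x y z : Fin n, x ≠ y ∧ y ≠ z ∧ x ≠ z ∧ s = {x, y, z} ∧ r x y ∧ r y z ∧ r x z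

/-- `s` contains a directed 4-cycle through all of its (four) elements. -/
def HasCycle4 {n : ℕ} (r : Fin n → Fin n → Prop) (s : Finset (Fin n)) : Prop :=
  ∃ a b c d : Fin n, a ≠ b ∧ a ≠ c ∧ a ≠ d ∧ b ≠ c ∧ b ≠ d ∧ c ≠ d ∧
    s = {a, b, c, d} ∧ r a b ∧ r b c ∧ r c d ∧ r d a

/-- `s` spans a transitive 4-vertex subtournament. -/
def IsTrans4 {n : ℕ} (r : Fin n → Fin n → Prop) (s : Finset (Fin n)) : Prop :=
  ∃ a b c d : Fin n, a ≠ b ∧ a ≠ c ∧ a ≠ d ∧ b ≠ c ∧ b ≠ d ∧ c ≠ d ∧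
    s = {a, b, c, d} ∧ r a b ∧ r a c ∧ r a d ∧ r b c ∧ r b d ∧ r c d

open Classical in
/-- `C3(T)`: number of 3-element vertex subsets spanning a cyclic triangle. -/
noncomputable def cyc3Count {n : ℕ} (r : Fin n → Fin n → Prop) : ℕ :=
  ((univ.powersetCard 3).filter (fun s => IsCyclicTriple r s)).card

open Classical in
/-- `T3(T)`: number of 3-element vertex subsets spanning a transitive triple. -/
noncomputable def trans3Count {n : ℕ} (r : Fin n → Fin n → Prop) : ℕ :=
  ((univ.powersetCard 3).filter (fun s => IsTransTriple r s)).card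

open Classical in
/-- `C4(T)`: number of 4-element vertex subsets containing a directed 4-cycle. -/
noncomputable def cyc4Count {n : ℕ} (r : Fin n → Fin n → Prop) : ℕ :=
  ((univ.powersetCard 4).filter (fun s => HasCycle4 r s)).card

open Classical in
/-- `T4(T)`: number of 4-element vertex subsets spanning a transitive subtournament. -/
noncomputable def trans4Count {n : ℕ} (r : Fin n → Fin n → Prop) : ℕ :=
  ((univ.powersetCard 4).filter (fun s => IsTrans4 r s)).card

open Polynomial in
theorem aux_det_aeval {n : ℕ} (M : Matrix (Fin n) (Fin n) ℂ) (p : ℂ[X]) :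
    (aeval M p).det = (M.charpoly.roots.map (fun z => p.eval z)).prod := by
  have hcard : M.charpoly.roots.card = n := by
    have := (IsAlgClosed.splits M.charpoly).natDegree_eq_card_roots
    rw [← this]; simp
  let F : ℂ[X] →* ℂ := Matrix.detMonoidHom.comp ((aeval M : ℂ[X] →ₐ[ℂ] Matrix (Fin n) (Fin n) ℂ) : ℂ[X] →* Matrix (Fin n) (Fin n) ℂ)
  let G : ℂ[X] →* ℂ :=
    { toFun := fun p => (M.charpoly.roots.map (fun z => p.eval z)).prod
      map_one' := by simp
      map_mul' := by intro a b; simp [Multiset.prod_map_mul] }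
  have hC : ∀ a : ℂ, F (C a) = G (C a) := by
    intro a
    simp [F, G, hcard, Matrix.algebraMap_eq_diagonal]
  have hX : ∀ a : ℂ, F (X - C a) = G (X - C a) := by
    intro a
    have h1 : M.charpoly.eval a = (M.charpoly.roots.map (fun z => a - z)).prod := by
      conv_lhs => rw [(IsAlgClosed.splits M.charpoly).eq_prod_roots_of_monic M.charpoly_monic]
      rw [eval_multiset_prod, Multiset.map_map]
      simp
    have h2 : F (X - C a) = (-1) ^ n * M.charpoly.eval a := by
      rw [Matrix.eval_charpoly]
      have : (aeval M (X - C a)) = - (Matrix.scalar (Fin n) a - M) := by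
        simp [Matrix.algebraMap_eq_diagonal]
      simp only [F, MonoidHom.comp_apply, Matrix.coe_detMonoidHom]
      change ((aeval M (X - C a))).det = _
      rw [this, Matrix.det_neg]; simp
    rw [h2, h1]
    change _ = (M.charpoly.roots.map (fun z => (X - C a).eval z)).prod
    have : (fun z => (X - C a).eval z) = fun z => (-1) * (a - z) := by
      funext z; simp
    rw [this, Multiset.prod_map_mul]; simp [hcard]
  change F p = G p
  rw [(IsAlgClosed.splits p).eq_prod_roots, map_mul, map_mul, hC, map_multiset_prod,
    map_multiset_prod, Multiset.map_map, Multiset.map_map]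
  congr 2
  apply Multiset.map_congr rfl
  intro x _
  exact hX x

open Polynomial in
theorem aux_trace_pow {n : ℕ} (M : Matrix (Fin n) (Fin n) ℂ) (k : ℕ) :
    (M ^ k).trace = (M.charpoly.roots.map (fun z => z ^ k)).sum := by
  have h : (M ^ k).charpoly = ((M.charpoly.roots.map (fun z => z ^ k)).map (fun a => X - C a)).prod := by
    apply Polynomial.funext
    intro t
    have := aux_det_aeval M (C t - X ^ k)
    rw [Matrix.eval_charpoly, eval_multiset_prod, Multiset.map_map, Multiset.map_map]
    simp [Matrix.algebraMap_eq_diagonal] at this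
    simp [Function.comp_def]
    exact this
  rw [Matrix.trace_eq_sum_roots_charpoly, h, roots_multiset_prod_X_sub_C]

theorem aux_f_good (z : ℂ) (h0 : 0 ≤ z.re) (h : z.re ≤ 3 / 16 ∨ z.im = 0) :
    0 ≤ (z ^ 4).re - 3 / 8 * (z ^ 3).re + z.re / 128 := by
  obtain ⟨x, y⟩ := z
  simp only at h0 h
  simp [pow_succ]
  have key : 0 ≤ x * (x - 1/4)^2 * (x + 1/8) + y^2 * (y^2 - 6*x^2 + 9*x/8) := by
    have h1 : 0 ≤ x * (x - 1/4)^2 * (x + 1/8) := by positivity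
    have h2 : 0 ≤ y^2 * (y^2 - 6*x^2 + 9*x/8) := by
      rcases h with h | h
      · apply mul_nonneg (sq_nonneg _)
        nlinarith [mul_nonneg h0 (sub_nonneg.2 h), sq_nonneg y]
      · simp [h]
    linarith
  nlinarith [key]

theorem aux_f_bad (z : ℂ) (h0 : 0 ≤ z.re) (h : z.re ≤ 1 / 4) :
    - (3 / 32 * z.im ^ 2) ≤ (z ^ 4).re - 3 / 8 * (z ^ 3).re + z.re / 128 := by
  obtain ⟨x, y⟩ := z
  simp only at h0 h ⊢
  simp [pow_succ]
  have key : -(3/32*y^2) ≤ x * (x - 1/4)^2 * (x + 1/8) + y^2 * (y^2 - 6*x^2 + 9*x/8) := by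
    have h1 : 0 ≤ x * (x - 1/4)^2 * (x + 1/8) := by positivity
    have h2 : 0 ≤ y^2 * (y^2 - 6*x^2 + 9*x/8 + 3/32) := by
      apply mul_nonneg (sq_nonneg _)
      nlinarith [mul_nonneg h0 (sub_nonneg.2 h), sq_nonneg y]
    linarith
  nlinarith [key]

theorem aux_sum_f (S : Multiset ℂ) :
    (S.map (fun z : ℂ => (z ^ 4).re - 3 / 8 * (z ^ 3).re + z.re / 128)).sum =
    (S.map (fun z : ℂ => (z ^ 4).re)).sum - 3 / 8 * (S.map (fun z : ℂ => (z ^ 3).re)).sum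
      + (S.map (fun z : ℂ => z.re)).sum / 128 := by
  induction S using Multiset.induction_on with
  | empty => simp
  | cons a s ih => simp only [Multiset.map_cons, Multiset.sum_cons, ih]; ring

theorem aux_re_le_sum (S : Multiset ℂ) (h0 : ∀ z ∈ S, 0 ≤ z.re) :
    ∀ z ∈ S, z.re ≤ (S.map (fun z : ℂ => z.re)).sum := by
  intro z hz
  apply Multiset.single_le_sum
  · intro x hx
    obtain ⟨w, hw, rfl⟩ := Multiset.mem_map.1 hx
    exact h0 w hw
  · exact Multiset.mem_map_of_mem _ hz

theorem aux_cubes (S : Multiset ℂ) (h0 : ∀ z ∈ S, 0 ≤ z.re) (h1 : ∀ z ∈ S, z.re ≤ 1 / 8) :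
    (S.map (fun z : ℂ => (z ^ 3).re)).sum ≤ (S.map (fun z : ℂ => z.re)).sum / 64 := by
  rw [← Multiset.sum_map_div]
  apply Multiset.sum_map_le_sum_map
  intro z hz
  have a := h0 z hz
  have b := h1 z hz
  obtain ⟨x, y⟩ := z
  simp only at a b ⊢
  simp [pow_succ]
  have : 0 ≤ x * y^2 := by positivity
  have : x * x^2 ≤ x * (1/64) := by
    apply mul_le_mul_of_nonneg_left _ a
    nlinarith
  nlinarith

open ComplexConjugate in
theorem aux_spec (S : Multiset ℂ) (δ : ℝ) (hδ : 0 ≤ δ) (h0 : ∀ z ∈ S, 0 ≤ z.re)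
    (h1 : (S.map (fun z : ℂ => z.re)).sum = 1 / 2)
    (h3 : 1 / 32 - δ ≤ (S.map (fun z : ℂ => (z ^ 3).re)).sum)
    (hc : ∀ z ∈ S, conj z ∈ S) :
    1 / 128 - δ ≤ (S.map (fun z : ℂ => (z ^ 4).re)).sum := by
  have hf := aux_sum_f S
  by_cases hb : ∀ z ∈ S, z.re ≤ 3 / 16 ∨ z.im = 0
  · have : 0 ≤ (S.map (fun z : ℂ => (z ^ 4).re - 3 / 8 * (z ^ 3).re + z.re / 128)).sum := by
      apply Multiset.sum_nonneg
      intro x hx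
      obtain ⟨w, hw, rfl⟩ := Multiset.mem_map.1 hx
      exact aux_f_good w (h0 w hw) (hb w hw)
    linarith
  · push Not at hb
    obtain ⟨z, hz, hx, hy⟩ := hb
    obtain ⟨S1, rfl⟩ := Multiset.exists_cons_of_mem hz
    have hcz : conj z ∈ S1 := by
      have := hc z hz
      rw [Multiset.mem_cons] at this
      rcases this with h | h
      · exact absurd (Complex.conj_eq_iff_im.1 h) hy
      · exact h
    obtain ⟨S2, rfl⟩ := Multiset.exists_cons_of_mem hcz
    have h02 : ∀ w ∈ S2, 0 ≤ w.re := fun w hw => h0 w (by simp [hw])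
    have hle := aux_re_le_sum S2 h02
    have hnn : 0 ≤ (S2.map (fun z : ℂ => z.re)).sum := by
      apply Multiset.sum_nonneg
      intro x hx
      obtain ⟨w, hw, rfl⟩ := Multiset.mem_map.1 hx
      exact h02 w hw
    have e3 : ((conj z) ^ 3).re = (z ^ 3).re := by rw [← map_pow, Complex.conj_re]
    have e4 : ((conj z) ^ 4).re = (z ^ 4).re := by rw [← map_pow, Complex.conj_re]
    simp only [Multiset.map_cons, Multiset.sum_cons, Complex.conj_re, e3, e4] at h1 h3 hf ⊢
    have h18 : ∀ w ∈ S2, w.re ≤ 1 / 8 := fun w hw => by have := hle w hw; linarith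
    have hcub := aux_cubes S2 h02 h18
    have hfz := aux_f_bad z (by linarith) (by linarith)
    have hf2 : 0 ≤ (S2.map (fun z : ℂ => (z ^ 4).re - 3 / 8 * (z ^ 3).re + z.re / 128)).sum := by
      apply Multiset.sum_nonneg
      intro x hx
      obtain ⟨w, hw, rfl⟩ := Multiset.mem_map.1 hx
      exact aux_f_good w (h02 w hw) (Or.inl (by linarith [h18 w hw]))
    have ez : (z ^ 3).re = z.re ^ 3 - 3 * z.re * z.im ^ 2 := by
      simp [pow_succ]; ring
    have hyb : 9 / 8 * z.im ^ 2 ≤ δ := by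
      set s := (S2.map (fun z : ℂ => z.re)).sum with hs
      have hxs : z.re = 1 / 4 - s / 2 := by linarith
      have hs8 : s ≤ 1 / 8 := by linarith
      have p1 : 2 * z.re ^ 3 + s / 64 ≤ 1 / 32 := by
        rw [hxs]
        have : 0 ≤ s ^ 3 := by positivity
        nlinarith [mul_nonneg hnn (sub_nonneg.2 hs8)]
      have p2 : 3 / 16 * z.im ^ 2 ≤ z.re * z.im ^ 2 :=
        mul_le_mul_of_nonneg_right hx.le (sq_nonneg _)
      nlinarith
    linarith

theorem aux_fiber0 {n : ℕ} (r : Fin n → Fin n → Prop) (irr : ∀ u, ¬ r u u)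
    (asy : ∀ u v, r u v → ¬ r v u)
    {x y z w b c d : Fin n} (h1 : r x y) (h2 : r y z) (h3 : r z w) (h4 : r w x)
    (k1 : r x b) (k2 : r b c) (k3 : r c d) (k4 : r d x)
    (hb : b = x ∨ b = y ∨ b = z ∨ b = w)
    (hc : c = x ∨ c = y ∨ c = z ∨ c = w) (hd : d = x ∨ d = y ∨ d = z ∨ d = w)
    (hac : x ≠ c) (hbd : b ≠ d) : b = y ∧ c = z ∧ d = w := by
  have a1 := asy _ _ h1
  have a2 := asy _ _ h2
  have a3 := asy _ _ h3
  have a4 := asy _ _ h4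
  have i1 := irr x
  have i2 := irr y
  have i3 := irr z
  have i4 := irr w
  clear irr asy
  have hc' : c = y ∨ c = z ∨ c = w := by
    rcases hc with h | h
    · exact absurd h.symm hac
    · exact h
  clear hc
  have hd' : d = z ∨ d = w := by
    rcases hd with h | h | h | h
    · exact absurd (h ▸ k4) i1
    · exact absurd (h ▸ k4) a1
    · exact Or.inl h
    · exact Or.inr h
  clear hd
  have hb' : b = y ∨ b = z := by
    rcases hb with h | h | h | h
    · exact absurd (h ▸ k1) i1
    · exact Or.inl h
    · exact Or.inr h
    · exact absurd (h ▸ k1) a4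
  clear hb
  rcases hd' with hd' | hd'
  · have hby : b = y := by
      rcases hb' with h | h
      · exact h
      · exact absurd (h.trans hd'.symm) hbd
    rw [hby] at k2
    rw [hd'] at k3
    rcases hc' with h | h | h <;> rw [h] at k2 k3
    · exact absurd k2 i2
    · exact absurd k3 i3
    · exact absurd k3 a3
  · rw [hd'] at k3
    rcases hb' with hb' | hb' <;> rw [hb'] at k2
    · rcases hc' with h | h | h
      · rw [h] at k2; exact absurd k2 i2
      · exact ⟨hb', h, hd'⟩
      · rw [h] at k3; exact absurd k3 i4
    · rcases hc' with h | h | h <;> rw [h] at k2 k3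
      · exact absurd k2 a2
      · exact absurd k2 i3
      · exact absurd k3 i4

theorem aux_fiber4 {n : ℕ} (r : Fin n → Fin n → Prop) (irr : ∀ u, ¬ r u u)
    (asy : ∀ u v, r u v → ¬ r v u)
    {x y z w a b c d : Fin n} (h1 : r x y) (h2 : r y z) (h3 : r z w) (h4 : r w x)
    (k1 : r a b) (k2 : r b c) (k3 : r c d) (k4 : r d a)
    (ha : a = x ∨ a = y ∨ a = z ∨ a = w) (hb : b = x ∨ b = y ∨ b = z ∨ b = w)
    (hc : c = x ∨ c = y ∨ c = z ∨ c = w) (hd : d = x ∨ d = y ∨ d = z ∨ d = w)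
    (hac : a ≠ c) (hbd : b ≠ d) :
    (a, b, c, d) ∈ ({(x, y, z, w), (y, z, w, x), (z, w, x, y), (w, x, y, z)} :
      Finset (Fin n × Fin n × Fin n × Fin n)) := by
  have rot : ∀ {u x y z w : Fin n}, (u = x ∨ u = y ∨ u = z ∨ u = w) →
      (u = y ∨ u = z ∨ u = w ∨ u = x) := by
    intro u x y z w h
    rcases h with h | h | h | h
    · exact Or.inr (Or.inr (Or.inr h))
    · exact Or.inl h
    · exact Or.inr (Or.inl h)
    · exact Or.inr (Or.inr (Or.inl h))
  simp only [Finset.mem_insert, Finset.mem_singleton, Prod.mk.injEq]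
  rcases ha with rfl | rfl | rfl | rfl
  · have e := aux_fiber0 r irr asy h1 h2 h3 h4 k1 k2 k3 k4 hb hc hd hac hbd
    exact Or.inl ⟨rfl, e⟩
  · have e := aux_fiber0 r irr asy h2 h3 h4 h1 k1 k2 k3 k4
      (rot hb) (rot hc) (rot hd) hac hbd
    exact Or.inr (Or.inl ⟨rfl, e⟩)
  · have e := aux_fiber0 r irr asy h3 h4 h1 h2 k1 k2 k3 k4
      (rot (rot hb)) (rot (rot hc)) (rot (rot hd)) hac hbd
    exact Or.inr (Or.inr (Or.inl ⟨rfl, e⟩))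
  · have e := aux_fiber0 r irr asy h4 h1 h2 h3 k1 k2 k3 k4
      (rot (rot (rot hb))) (rot (rot (rot hc))) (rot (rot (rot hd))) hac hbd
    exact Or.inr (Or.inr (Or.inr ⟨rfl, e⟩))

open Classical in
theorem aux_C4 {n : ℕ} (r : Fin n → Fin n → Prop) (hr : IsTournament r) :
    ((univ : Finset (Fin n × Fin n × Fin n × Fin n)).filter
      (fun p => r p.1 p.2.1 ∧ r p.2.1 p.2.2.1 ∧ r p.2.2.1 p.2.2.2 ∧ r p.2.2.2 p.1)).card
      ≤ 4 * cyc4Count r := by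
  have irr := hr.1
  have asy : ∀ u v, r u v → ¬ r v u := by
    intro u v huv hvu
    by_cases e : u = v
    · subst e; exact irr _ huv
    · rcases hr.2 u v e with h | h
      · exact h.2 hvu
      · exact h.2 huv
  have ne : ∀ u v, r u v → u ≠ v := by rintro u v h rfl; exact irr _ h
  unfold cyc4Count
  apply Finset.card_le_mul_card_image_of_maps_to
    (f := fun p : Fin n × Fin n × Fin n × Fin n => ({p.1, p.2.1, p.2.2.1, p.2.2.2} : Finset (Fin n)))
  · rintro ⟨a, b, c, d⟩ h
    simp only [Finset.mem_filter, Finset.mem_univ, true_and] at h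
    obtain ⟨k1, k2, k3, k4⟩ := h
    have hac : a ≠ c := by rintro rfl; exact asy _ _ k1 k2
    have hbd : b ≠ d := by rintro rfl; exact asy _ _ k2 k3
    have n1 := ne _ _ k1
    have n2 := ne _ _ k2
    have n3 := ne _ _ k3
    have n4 := ne _ _ k4
    simp only [Finset.mem_filter, Finset.mem_powersetCard, Finset.subset_univ, true_and]
    refine ⟨?_, a, b, c, d, n1, hac, n4.symm, n2, hbd, n3, rfl, k1, k2, k3, k4⟩
    rw [Finset.card_insert_of_notMem, Finset.card_insert_of_notMem, Finset.card_insert_of_notMem,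
      Finset.card_singleton] <;> simp [*, n4.symm]
  · intro s hs
    simp only [Finset.mem_filter, Finset.mem_powersetCard, Finset.subset_univ, true_and] at hs
    obtain ⟨-, x, y, z, w, -, -, -, -, -, -, rfl, h1, h2, h3, h4⟩ := hs
    refine le_trans (Finset.card_le_card (t := {(x, y, z, w), (y, z, w, x), (z, w, x, y), (w, x, y, z)}) ?_) Finset.card_le_four
    rintro ⟨a, b, c, d⟩ h
    simp only [Finset.mem_filter, Finset.mem_univ, true_and] at h
    obtain ⟨⟨k1, k2, k3, k4⟩, he⟩ := h
    have hac : a ≠ c := by rintro rfl; exact asy _ _ k1 k2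
    have hbd : b ≠ d := by rintro rfl; exact asy _ _ k2 k3
    have mem : ∀ u, u ∈ ({a, b, c, d} : Finset (Fin n)) → u = x ∨ u = y ∨ u = z ∨ u = w := by
      intro u hu
      rw [he] at hu
      simpa using hu
    exact aux_fiber4 r irr asy h1 h2 h3 h4 k1 k2 k3 k4 (mem a (by simp)) (mem b (by simp))
      (mem c (by simp)) (mem d (by simp)) hac hbd

open Classical in
theorem aux_C3 {n : ℕ} (r : Fin n → Fin n → Prop) :
    3 * cyc3Count r ≤ ((univ : Finset (Fin n × Fin n × Fin n)).filter
      (fun p => r p.1 p.2.1 ∧ r p.2.1 p.2.2 ∧ r p.2.2 p.1)).card := by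
  unfold cyc3Count
  rw [mul_comm]
  set T := ((univ : Finset (Fin n × Fin n × Fin n)).filter
      (fun p => r p.1 p.2.1 ∧ r p.2.1 p.2.2 ∧ r p.2.2 p.1)) with hT
  set U := ((univ.powersetCard 3).filter (fun s => IsCyclicTriple r s)) with hU
  let f := fun p : Fin n × Fin n × Fin n => ({p.1, p.2.1, p.2.2} : Finset (Fin n))
  have h1 : U.card * 3 ≤ ∑ s ∈ U, (T.filter (fun p => f p = s)).card := by
    rw [← smul_eq_mul]
    apply Finset.card_nsmul_le_sum
    intro s hs
    simp only [hU, Finset.mem_filter] at hs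
    obtain ⟨-, x, y, z, hxy, hyz, hxz, rfl, k1, k2, k3⟩ := hs
    have : ({(x, y, z), (y, z, x), (z, x, y)} : Finset (Fin n × Fin n × Fin n)).card = 3 := by
      rw [Finset.card_eq_three]
      exact ⟨_, _, _, by simp [hxy], by simp [hxz], by simp [hyz], rfl⟩
    rw [← this]
    apply Finset.card_le_card
    intro p hp
    simp only [Finset.mem_insert, Finset.mem_singleton] at hp
    rcases hp with rfl | rfl | rfl <;> simp only [hT, f, Finset.mem_filter, Finset.mem_univ, true_and] <;>
      refine ⟨⟨by assumption, by assumption, by assumption⟩, ?_⟩ <;> first | trivial | rfl | (ext u; simp; tauto)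
  refine h1.trans ?_
  rw [← Finset.card_biUnion]
  · apply Finset.card_le_card
    intro p hp
    simp only [Finset.mem_biUnion, Finset.mem_filter] at hp
    obtain ⟨_, _, h, _⟩ := hp
    exact h
  · intro s _ t _ hst
    rw [Function.onFun, Finset.disjoint_left]
    intro p hp hq
    simp only [Finset.mem_filter] at hp hq
    exact hst (hp.2.symm.trans hq.2)

open Classical in
noncomputable def auxA {n : ℕ} (r : Fin n → Fin n → Prop) : Matrix (Fin n) (Fin n) ℝ :=
  Matrix.of fun i j => if r i j then 1 else 0

noncomputable def auxB {n : ℕ} (r : Fin n → Fin n → Prop) : Matrix (Fin n) (Fin n) ℝ :=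
  auxA r + (1 / 2 : ℝ) • 1

theorem auxB_symm {n : ℕ} (r : Fin n → Fin n → Prop) (hr : IsTournament r) (i j : Fin n) :
    auxB r i j + auxB r j i = 1 := by
  by_cases e : i = j
  · subst e
    have := hr.1 i
    simp [auxB, auxA, this]; norm_num
  · have e2 : j ≠ i := fun h => e h.symm
    rcases hr.2 i j e with h | h <;> simp [auxB, auxA, h, e, e2]

theorem aux_trA {n : ℕ} (r : Fin n → Fin n → Prop) (hr : IsTournament r) :
    (auxA r).trace = 0 := by
  simp [Matrix.trace, auxA, hr.1]

theorem aux_trA2 {n : ℕ} (r : Fin n → Fin n → Prop) (hr : IsTournament r) :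
    (auxA r ^ 2).trace = 0 := by
  simp only [Matrix.trace, pow_two, Matrix.mul_apply, Matrix.diag]
  apply Finset.sum_eq_zero
  intro i _
  apply Finset.sum_eq_zero
  intro j _
  by_cases e : i = j
  · subst e; simp [auxA, hr.1]
  · rcases hr.2 i j e with h | h <;> simp [auxA, h]

open Classical in
theorem aux_trA3 {n : ℕ} (r : Fin n → Fin n → Prop) :
    (auxA r ^ 3).trace = (((univ : Finset (Fin n × Fin n × Fin n)).filter
      (fun p => r p.1 p.2.1 ∧ r p.2.1 p.2.2 ∧ r p.2.2 p.1)).card : ℝ) := by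
  rw [Finset.card_filter]
  push_cast
  simp only [Fintype.sum_prod_type]
  rw [pow_succ', pow_two]
  simp only [Matrix.trace, Matrix.mul_apply, Matrix.diag, Finset.mul_sum]
  refine Finset.sum_congr rfl fun a _ => Finset.sum_congr rfl fun b _ =>
    Finset.sum_congr rfl fun c _ => ?_
  simp only [auxA, Matrix.of_apply]
  by_cases h1 : r a b <;> by_cases h2 : r b c <;> by_cases h3 : r c a <;> simp [h1, h2, h3]

open Classical in
theorem aux_trA4 {n : ℕ} (r : Fin n → Fin n → Prop) :
    (auxA r ^ 4).trace = (((univ : Finset (Fin n × Fin n × Fin n × Fin n)).filter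
      (fun p => r p.1 p.2.1 ∧ r p.2.1 p.2.2.1 ∧ r p.2.2.1 p.2.2.2 ∧ r p.2.2.2 p.1)).card : ℝ) := by
  rw [Finset.card_filter]
  push_cast
  simp only [Fintype.sum_prod_type]
  rw [pow_succ', pow_succ', pow_two]
  simp only [Matrix.trace, Matrix.mul_apply, Matrix.diag, Finset.mul_sum]
  refine Finset.sum_congr rfl fun a _ => Finset.sum_congr rfl fun b _ =>
    Finset.sum_congr rfl fun c _ => Finset.sum_congr rfl fun d _ => ?_
  simp only [auxA, Matrix.of_apply]
  by_cases h1 : r a b <;> by_cases h2 : r b c <;> by_cases h3 : r c d <;> by_cases h4 : r d a <;>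
    simp [h1, h2, h3, h4]

theorem aux_trA3_le {n : ℕ} (r : Fin n → Fin n → Prop) :
    (auxA r ^ 3).trace ≤ (n : ℝ) ^ 3 := by
  classical
  rw [aux_trA3]
  have : ((univ : Finset (Fin n × Fin n × Fin n)).filter
      (fun p => r p.1 p.2.1 ∧ r p.2.1 p.2.2 ∧ r p.2.2 p.1)).card ≤ n ^ 3 := by
    refine (Finset.card_le_univ _).trans (le_of_eq ?_)
    simp; ring
  exact_mod_cast this

theorem aux_trB {n : ℕ} (r : Fin n → Fin n → Prop) (hr : IsTournament r) :
    (auxB r).trace = n / 2 := by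
  simp [auxB, aux_trA r hr]; ring

theorem aux_trB3 {n : ℕ} (r : Fin n → Fin n → Prop) (hr : IsTournament r) :
    (auxB r ^ 3).trace = (auxA r ^ 3).trace + n / 8 := by
  have : auxB r ^ 3 = auxA r ^ 3 + (3 / 2 : ℝ) • auxA r ^ 2 + (3 / 4 : ℝ) • auxA r
      + (1 / 8 : ℝ) • 1 := by
    have := congrArg (Polynomial.aeval (auxA r)) (show
      ((Polynomial.X + Polynomial.C (1/2)) ^ 3 : Polynomial ℝ) = Polynomial.X ^ 3 +
        Polynomial.C (3/2) * Polynomial.X ^ 2 + Polynomial.C (3/4) * Polynomial.X +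
        Polynomial.C (1/8) by
          apply Polynomial.funext; intro x; simp; ring)
    simpa [Algebra.algebraMap_eq_smul_one, auxB] using this
  rw [this]
  simp only [Matrix.trace_add, Matrix.trace_smul, aux_trA r hr, aux_trA2 r hr, Matrix.trace_one]
  simp; ring

theorem aux_trB4 {n : ℕ} (r : Fin n → Fin n → Prop) (hr : IsTournament r) :
    (auxB r ^ 4).trace = (auxA r ^ 4).trace + 2 * (auxA r ^ 3).trace + n / 16 := by
  have : auxB r ^ 4 = auxA r ^ 4 + (2 : ℝ) • auxA r ^ 3 + (3 / 2 : ℝ) • auxA r ^ 2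
      + (1 / 2 : ℝ) • auxA r + (1 / 16 : ℝ) • 1 := by
    have := congrArg (Polynomial.aeval (auxA r)) (show
      ((Polynomial.X + Polynomial.C (1/2)) ^ 4 : Polynomial ℝ) = Polynomial.X ^ 4 +
        Polynomial.C 2 * Polynomial.X ^ 3 +
        Polynomial.C (3/2) * Polynomial.X ^ 2 + Polynomial.C (1/2) * Polynomial.X +
        Polynomial.C (1/16) by
          apply Polynomial.funext; intro x; simp; ring)
    simp only [map_add, map_mul, map_pow, Polynomial.aeval_X, Polynomial.aeval_C,
      Algebra.algebraMap_eq_smul_one, smul_mul_assoc, one_mul] at this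
    exact this
  rw [this]
  simp only [Matrix.trace_add, Matrix.trace_smul, aux_trA r hr, aux_trA2 r hr, Matrix.trace_one]
  simp; ring

noncomputable def auxM {n : ℕ} (r : Fin n → Fin n → Prop) : Matrix (Fin n) (Fin n) ℂ :=
  (auxB r).map Complex.ofRealHom

theorem auxM_trace_pow {n : ℕ} (r : Fin n → Fin n → Prop) (k : ℕ) :
    ((auxM r).charpoly.roots.map (fun z : ℂ => (z ^ k).re)).sum = (auxB r ^ k).trace := by
  have h := aux_trace_pow (auxM r) k
  have h2 : ((auxM r) ^ k).trace = (((auxB r ^ k).trace : ℝ) : ℂ) := by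
    have : (auxM r) ^ k = (auxB r ^ k).map Complex.ofRealHom := by
      have := map_pow (Complex.ofRealHom.mapMatrix (m := Fin n)) (auxB r) k
      simpa [auxM] using this.symm
    rw [this]
    simp [Matrix.trace]
  rw [h2] at h
  have h3 := congrArg Complex.reAddGroupHom h
  rw [map_multiset_sum, Multiset.map_map] at h3
  simpa [Function.comp_def] using h3.symm

open ComplexConjugate in
theorem auxM_conj {n : ℕ} (r : Fin n → Fin n → Prop) (z : ℂ)
    (hz : z ∈ (auxM r).charpoly.roots) : conj z ∈ (auxM r).charpoly.roots := by
  have hne := (auxM r).charpoly_monic.ne_zero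
  rw [Polynomial.mem_roots hne, Polynomial.IsRoot] at hz ⊢
  rw [auxM, Matrix.charpoly_map] at hz ⊢
  rw [Polynomial.eval_map] at hz ⊢
  have := congrArg (starRingEnd ℂ) hz
  rw [Polynomial.hom_eval₂] at this
  have e : (starRingEnd ℂ).comp Complex.ofRealHom = Complex.ofRealHom := by
    ext x; simp
  rw [e] at this
  simpa using this

open ComplexConjugate in
theorem auxM_re {n : ℕ} (r : Fin n → Fin n → Prop) (hr : IsTournament r) (z : ℂ)
    (hz : z ∈ (auxM r).charpoly.roots) : 0 ≤ z.re := by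
  have hne := (auxM r).charpoly_monic.ne_zero
  rw [Polynomial.mem_roots hne, Polynomial.IsRoot, Matrix.eval_charpoly] at hz
  obtain ⟨v, hv, hmv⟩ := Matrix.exists_mulVec_eq_zero_iff.2 hz
  have hmv' : ∀ i, ∑ j, (auxB r i j : ℂ) * v j = z * v i := by
    intro i
    have := congrFun hmv i
    rw [Matrix.sub_mulVec] at this
    simp [Matrix.mulVec, dotProduct, auxM] at this
    linear_combination -this
  have q1 : ∑ i, ∑ j, conj (v i) * ((auxB r i j : ℂ) * v j) = z * ∑ i, conj (v i) * v i := by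
    simp_rw [← Finset.mul_sum, hmv', Finset.mul_sum]
    refine Finset.sum_congr rfl fun i _ => by ring
  have q2 : ∑ i, ∑ j, conj (v i) * ((auxB r j i : ℂ) * v j) = conj z * ∑ i, conj (v i) * v i := by
    rw [Finset.sum_comm]
    have : ∀ j, ∑ i, conj (v i) * ((auxB r j i : ℂ) * v j) = conj (z * v j) * v j := by
      intro j
      rw [← hmv' j, map_sum, Finset.sum_mul]
      refine Finset.sum_congr rfl fun i _ => ?_
      simp; ring
    simp_rw [this, Finset.mul_sum]
    refine Finset.sum_congr rfl fun i _ => by simp; ring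
  have q3 : ∑ i, ∑ j, conj (v i) * ((auxB r i j : ℂ) * v j)
      + ∑ i, ∑ j, conj (v i) * ((auxB r j i : ℂ) * v j) = conj (∑ i, v i) * ∑ j, v j := by
    rw [map_sum, Finset.sum_mul_sum, ← Finset.sum_add_distrib]
    refine Finset.sum_congr rfl fun i _ => ?_
    rw [← Finset.sum_add_distrib]
    refine Finset.sum_congr rfl fun j _ => ?_
    have h : (auxB r i j : ℂ) + (auxB r j i : ℂ) = 1 := by exact_mod_cast auxB_symm r hr i j
    linear_combination (conj (v i) * v j) * h
  rw [q1, q2, ← add_mul, Complex.add_conj] at q3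
  simp_rw [← Complex.normSq_eq_conj_mul_self] at q3
  have q4 : 2 * z.re * ∑ i, Complex.normSq (v i) = Complex.normSq (∑ i, v i) := by
    exact_mod_cast q3
  have hpos : 0 < ∑ i, Complex.normSq (v i) := by
    obtain ⟨i, hi⟩ := Function.ne_iff.1 hv
    exact Finset.sum_pos' (fun i _ => Complex.normSq_nonneg _)
      ⟨i, Finset.mem_univ _, Complex.normSq_pos.2 hi⟩
  by_contra hneg
  push Not at hneg
  have := Complex.normSq_nonneg (∑ i, v i)
  nlinarith

open ComplexConjugate in
theorem aux_main {n : ℕ} (hn : 0 < n) (r : Fin n → Fin n → Prop) (hr : IsTournament r)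
    (δ : ℝ) (hδ : 0 ≤ δ) (h3 : (1 / 32 - δ) * n ^ 3 ≤ (auxB r ^ 3).trace) :
    (1 / 128 - δ) * n ^ 4 ≤ (auxB r ^ 4).trace := by
  have hn' : (0 : ℝ) < n := by exact_mod_cast hn
  set S := (auxM r).charpoly.roots.map (fun z : ℂ => z / ((n : ℝ) : ℂ)) with hS
  have hk : ∀ k : ℕ, (S.map (fun z : ℂ => (z ^ k).re)).sum = (auxB r ^ k).trace / (n : ℝ) ^ k := by
    intro k
    rw [← auxM_trace_pow, hS, Multiset.map_map, ← Multiset.sum_map_div]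
    congr 1
    apply Multiset.map_congr rfl
    intro z _
    simp only [Function.comp, div_pow]
    rw [← Complex.ofReal_pow, Complex.div_ofReal_re]
  have := aux_spec S δ hδ ?_ ?_ ?_ ?_
  · rw [hk 4, le_div_iff₀ (by positivity)] at this
    exact this
  · intro w hw
    obtain ⟨z, hz, rfl⟩ := Multiset.mem_map.1 hw
    rw [Complex.div_ofReal_re]
    exact div_nonneg (auxM_re r hr z hz) hn'.le
  · have := hk 1
    simp only [pow_one] at this
    rw [this, aux_trB r hr]
    field_simp
  · rw [hk 3, le_div_iff₀ (by positivity)]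
    exact h3
  · intro w hw
    obtain ⟨z, hz, rfl⟩ := Multiset.mem_map.1 hw
    refine Multiset.mem_map.2 ⟨conj z, auxM_conj r z hz, ?_⟩
    simp

theorem aux_choose4 (n : ℕ) : (n.choose 4 : ℝ) ≤ n ^ 4 / 24 := by
  have := Nat.choose_le_pow_div (α := ℝ) 4 n
  simpa [Nat.factorial] using this

theorem aux_choose3 (n : ℕ) (hn : 2 ≤ n) : (n.choose 3 : ℝ) = n * (n - 1) * (n - 2) / 6 := by
  obtain ⟨m, rfl⟩ := Nat.exists_eq_add_of_le hn
  have := Nat.cast_choose_eq_ascPochhammer_div ℝ (2 + m) 3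
  rw [this]
  simp [ascPochhammer_succ_right, Nat.factorial]
  ring

/-- for every `ε > 0` there is `N` such that every tournament on
`n ≥ N` vertices with `c3 ≥ 1/16` satisfies `c4 ≥ 3/64 − ε`. -/
theorem stmt_10 :
    ∀ ε : ℝ, 0 < ε → ∃ N : ℕ, ∀ n : ℕ, N ≤ n → ∀ r : Fin n → Fin n → Prop,
      IsTournament r →
        (cyc3Count r : ℝ) / (n.choose 3 : ℝ) ≥ 1 / 16 →
          (cyc4Count r : ℝ) / (n.choose 4 : ℝ) ≥ 3 / 64 - ε := by
  intro ε hε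
  refine ⟨max 4 ⌈24 / ε⌉₊, ?_⟩
  intro n hn r hr h
  have hn4 : 4 ≤ n := le_trans (le_max_left _ _) hn
  have hn4' : (4 : ℝ) ≤ n := by exact_mod_cast hn4
  have hnpos : (0 : ℝ) < n := by linarith
  have hnε : 24 / ε ≤ n := by
    have : ⌈24 / ε⌉₊ ≤ n := le_trans (le_max_right _ _) hn
    exact (Nat.le_ceil _).trans (by exact_mod_cast this)
  have hε2 : 24 / (n : ℝ) ≤ ε := by
    rw [div_le_iff₀ hε] at hnε
    rw [div_le_iff₀ hnpos]
    linarith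
  have hc4pos : (0 : ℝ) < n.choose 4 := by exact_mod_cast Nat.choose_pos hn4
  have hc3pos : (0 : ℝ) < n.choose 3 := by exact_mod_cast Nat.choose_pos (by omega)
  have hC3 : 3 * (cyc3Count r : ℝ) ≤ (auxA r ^ 3).trace := by
    rw [aux_trA3]; exact_mod_cast aux_C3 r
  have hC4 : (auxA r ^ 4).trace ≤ 4 * (cyc4Count r : ℝ) := by
    rw [aux_trA4]; exact_mod_cast aux_C4 r hr
  rw [ge_iff_le, le_div_iff₀ hc3pos, aux_choose3 n (by omega)] at h
  have h3 : (1 / 32 - 1 / (n : ℝ)) * n ^ 3 ≤ (auxB r ^ 3).trace := by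
    rw [aux_trB3 r hr]
    have e : (1 / 32 - 1 / (n : ℝ)) * n ^ 3 = n ^ 3 / 32 - n ^ 2 := by field_simp
    rw [e]
    nlinarith
  have hm := aux_main (by omega) r hr (1 / n) (by positivity) h3
  rw [aux_trB4 r hr] at hm
  have e : (1 / 128 - 1 / (n : ℝ)) * n ^ 4 = n ^ 4 / 128 - n ^ 3 := by field_simp
  rw [e] at hm
  have h3le := aux_trA3_le r
  have hnn : (n : ℝ) / 16 ≤ n ^ 3 := by
    have : (1 : ℝ) ≤ n ^ 2 := by nlinarith
    nlinarith
  have hfin : (n : ℝ) ^ 4 / 512 - n ^ 3 ≤ cyc4Count r := by linarith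
  rw [ge_iff_le]
  refine le_trans (sub_le_sub_left hε2 _) ?_
  rw [le_div_iff₀ hc4pos]
  rcases le_total (3 / 64 - 24 / (n : ℝ)) 0 with hneg | hpos
  · exact le_trans (mul_nonpos_of_nonpos_of_nonneg hneg hc4pos.le) (Nat.cast_nonneg _)
  · refine le_trans (mul_le_mul_of_nonneg_left (aux_choose4 n) hpos) (le_trans (le_of_eq ?_) hfin)
    field_simp
    ring
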